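/- Let B_1,…,B_m be d×d positive semidefinite matrices with tr(B_i) ≤ 1 for all i and Σ_{i=1}^m tr(B_i)·B_i ≤ I. Let Q(x, z_1,…,z_m, w_1,…,w_m) = det(x·I + Σ_{i=1}^m z_i B_i)·det(x·I + Σ_{i=1}^m w_i B_i). Then for any subset S ⊆ {1,…,m}, the point (4, 0,…,0) lies above the roots of the polynomial ∏_{i∈S} (1 − (1/2)·∂²_{z_i≡w_i}) Q, where ∂²_{z_i≡w_i} denotes identifying the variables z_i and w_i (substituting w_i := z_i) followed by the second order partial derivative ∂²_{z_i}. -/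

import Mathlib

open scoped ComplexOrder

/-- A real point is above the roots of a complex-coefficient polynomial `Q` in the
variables `σ` if the values `Q(z + t)`, `t ≥ 0`, are (real and) positive. -/
def AboveRootsC {σ : Type*} (Q : MvPolynomial σ ℂ) (z : σ → ℝ) : Prop :=
  ∀ t : σ → ℝ, (∀ i, 0 ≤ t i) →
    (MvPolynomial.eval (fun i => ((z i + t i : ℝ) : ℂ)) Q).im = 0 ∧
    0 < (MvPolynomial.eval (fun i => ((z i + t i : ℝ) : ℂ)) Q).re

/-- The determinantal polynomial
`Q(x,z,w) = det(x I + Σ z_i B_i)·det(x I + Σ w_i B_i)`, where the variable `x` is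
indexed by `none`, `z_i` by `some (inl i)` and `w_i` by `some (inr i)`. -/
noncomputable def detProdPoly {m d : ℕ} (B : Fin m → Matrix (Fin d) (Fin d) ℂ) :
    MvPolynomial (Option (Fin m ⊕ Fin m)) ℂ :=
  Matrix.det (Matrix.of fun a b =>
      MvPolynomial.X (none : Option (Fin m ⊕ Fin m)) * (if a = b then 1 else 0) +
        ∑ i, MvPolynomial.X (some (Sum.inl i)) * MvPolynomial.C (B i a b)) *
  Matrix.det (Matrix.of fun a b =>
      MvPolynomial.X (none : Option (Fin m ⊕ Fin m)) * (if a = b then 1 else 0) +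
        ∑ i, MvPolynomial.X (some (Sum.inr i)) * MvPolynomial.C (B i a b))

open Polynomial in
theorem tendsto_im_local_bound (p q : ℝ[X]) (η : ℝ) (m : ℕ)
    (hIm : ∀ w : ℂ, 0 < w.im →
      (aeval w q * starRingEnd ℂ (aeval w ((X - C η) ^ m * p))).im ≤ 0)
    {u : ℂ} (hu : 0 < u.im) : 0 ≤ q.eval η * p.eval η * (u ^ m).im := by
  let g : ℝ → ℝ := fun ε => (aeval ((η : ℂ) + ε * u) q *
    starRingEnd ℂ (u ^ m * aeval ((η : ℂ) + ε * u) p)).im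
  have hg : Continuous g := by
    refine Complex.continuous_im.comp (Continuous.mul ?_ (Complex.continuous_conj.comp
      (continuous_const.mul ?_)))
    · exact (q.continuous_aeval (A := ℂ)).comp (by fun_prop)
    · exact (p.continuous_aeval (A := ℂ)).comp (by fun_prop)
  have hneg : ∀ ε : ℝ, 0 < ε → g ε ≤ 0 := by
    intro ε hε
    have h := hIm ((η : ℂ) + ε * u) (by simpa using mul_pos hε hu)
    have e : aeval ((η : ℂ) + ε * u) q *
        starRingEnd ℂ (aeval ((η : ℂ) + ε * u) ((X - C η) ^ m * p)) =
        ((ε ^ m : ℝ) : ℂ) * (aeval ((η : ℂ) + ε * u) q *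
          starRingEnd ℂ (u ^ m * aeval ((η : ℂ) + ε * u) p)) := by
      simp only [map_mul, map_pow, map_sub, aeval_X, aeval_C, Complex.coe_algebraMap,
        Complex.conj_ofReal, add_sub_cancel_left, mul_pow, Complex.ofReal_pow]
      ring
    rw [e, Complex.im_ofReal_mul] at h
    exact nonpos_of_mul_nonpos_right h (pow_pos hε m)
  have h0 : g 0 ≤ 0 := by
    have ht : Filter.Tendsto g (nhdsWithin 0 (Set.Ioi 0)) (nhds (g 0)) :=
      (hg.tendsto 0).mono_left nhdsWithin_le_nhds
    exact le_of_tendsto ht (Filter.eventually_of_mem self_mem_nhdsWithin fun ε hε => hneg ε hε)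
  have hev : ∀ r : ℝ[X], aeval (η : ℂ) r = ((r.eval η : ℝ) : ℂ) := fun r => by
    simpa using aeval_algebraMap_apply ℂ η r
  have : g 0 = -(q.eval η * p.eval η * (u ^ m).im) := by
    simp only [g, Complex.ofReal_zero, zero_mul, add_zero, hev, map_mul, Complex.conj_ofReal]
    rw [Complex.im_ofReal_mul, Complex.im_mul_ofReal, Complex.conj_im]
    ring
  linarith

open Polynomial in
theorem simple_root_of_im_nonpos (p q : ℝ[X]) (η : ℝ) {m : ℕ} (hm : m ≠ 0)
    (hIm : ∀ w : ℂ, 0 < w.im →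
      (aeval w q * starRingEnd ℂ (aeval w ((X - C η) ^ m * p))).im ≤ 0)
    (hp : p.eval η ≠ 0) (hq : q.eval η ≠ 0) : m = 1 ∧ 0 ≤ q.eval η * p.eval η := by
  have key := fun u : ℂ => tendsto_im_local_bound p q η m hIm (u := u)
  have hm0 : (m : ℂ) ≠ 0 := by exact_mod_cast hm
  have hmR : (0 : ℝ) < m := by exact_mod_cast Nat.pos_of_ne_zero hm
  have h1 : 0 ≤ q.eval η * p.eval η := by
    have hle : Real.pi / (2 * m) < Real.pi := by
      rw [div_lt_iff₀ (by positivity)]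
      have : (1 : ℝ) ≤ m := by exact_mod_cast Nat.one_le_iff_ne_zero.mpr hm
      nlinarith [Real.pi_pos]
    have := key (Complex.exp ((Real.pi / (2 * m) : ℝ) * Complex.I)) (by
      rw [Complex.exp_ofReal_mul_I_im]
      exact Real.sin_pos_of_pos_of_lt_pi (by positivity) hle)
    rw [← Complex.exp_nat_mul, show (m : ℂ) * ((Real.pi / (2 * m) : ℝ) * Complex.I) =
      ((Real.pi / 2 : ℝ) : ℂ) * Complex.I by push_cast; field_simp,
      Complex.exp_ofReal_mul_I_im, Real.sin_pi_div_two] at this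
    linarith
  refine ⟨?_, h1⟩
  by_contra hne
  have h2 : (2 : ℝ) ≤ m := by exact_mod_cast (by omega : 2 ≤ m)
  have hle : 3 * Real.pi / (2 * m) < Real.pi := by
    rw [div_lt_iff₀ (by positivity)]
    nlinarith [Real.pi_pos]
  have := key (Complex.exp ((3 * Real.pi / (2 * m) : ℝ) * Complex.I)) (by
    rw [Complex.exp_ofReal_mul_I_im]
    exact Real.sin_pos_of_pos_of_lt_pi (by positivity) hle)
  rw [← Complex.exp_nat_mul, show (m : ℂ) * ((3 * Real.pi / (2 * m) : ℝ) * Complex.I) =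
    ((Real.pi / 2 + Real.pi : ℝ) : ℂ) * Complex.I by push_cast; field_simp; ring,
    Complex.exp_ofReal_mul_I_im, Real.sin_add_pi, Real.sin_pi_div_two] at this
  have : q.eval η * p.eval η = 0 := by linarith
  simp_all

open Polynomial in
/-- If `p` is real-rooted and `q / p` maps the upper half plane to the closed lower half plane,
then `q` lies, modulo `p`, in the cone generated by the quotients `p / (X - η)`. -/
theorem linear_nonpos_of_im_nonpos (p q : ℝ[X]) (hp0 : p ≠ 0) (hp : p.Splits)
    (hdeg : q.degree ≤ p.degree)
    (hIm : ∀ w : ℂ, 0 < w.im → (aeval w q * starRingEnd ℂ (aeval w p)).im ≤ 0)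
    (L : ℝ[X] →ₗ[ℝ] ℝ) (hLp : L p = 0)
    (hL : ∀ η s, p = (X - C η) * s → L s ≤ 0) : L q ≤ 0 := by
  induction hn : p.natDegree generalizing p q L with
  | zero =>
    obtain ⟨a, ha⟩ := natDegree_eq_zero.mp hn
    have ha0 : a ≠ 0 := by rintro rfl; exact hp0 (by rw [← ha, C_0])
    have hq : q = C (q.coeff 0) := eq_C_of_degree_le_zero (hdeg.trans (by
      rw [← ha]; exact degree_C_le))
    have : q = (q.coeff 0 / a) • p := by
      rw [← ha, smul_C, smul_eq_mul, div_mul_cancel₀ _ ha0]; exact hq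
    rw [this, map_smul, hLp, smul_zero]
  | succ n ih =>
    by_cases hcom : ∃ η, p.eval η = 0 ∧ q.eval η = 0
    · obtain ⟨η, hpη, hqη⟩ := hcom
      obtain ⟨p₁, rfl⟩ := dvd_iff_isRoot.mpr hpη
      obtain ⟨q₁, rfl⟩ := dvd_iff_isRoot.mpr hqη
      have hp₁ : p₁ ≠ 0 := right_ne_zero_of_mul hp0
      refine ih p₁ q₁ hp₁ (hp.of_dvd hp0 (dvd_mul_left _ _)) ?_ ?_
        (L ∘ₗ LinearMap.mulLeft ℝ (X - C η)) hLp ?_ ?_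
      · rw [degree_mul, degree_mul, degree_X_sub_C] at hdeg
        exact (WithBot.add_le_add_iff_left (by simp)).mp hdeg
      · intro w hw
        have h := hIm w hw
        have hne : w - (η : ℂ) ≠ 0 := by
          intro h0
          have : w.im = 0 := by rw [sub_eq_zero.mp h0]; simp
          exact hw.ne' this
        have e : aeval w ((X - C η) * q₁) * starRingEnd ℂ (aeval w ((X - C η) * p₁)) =
            ((Complex.normSq (w - η) : ℝ) : ℂ) * (aeval w q₁ * starRingEnd ℂ (aeval w p₁)) := by
          rw [← Complex.mul_conj]
          simp only [map_mul, map_sub, aeval_X, aeval_C, Complex.coe_algebraMap]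
          ring
        rw [e, Complex.im_ofReal_mul] at h
        exact nonpos_of_mul_nonpos_right h (Complex.normSq_pos.mpr hne)
      · rintro η' s rfl
        exact hL η' ((X - C η) * s) (by ring)
      · rw [natDegree_mul (X_sub_C_ne_zero _) hp₁, natDegree_X_sub_C] at hn
        omega
    · push Not at hcom
      have hloc : ∀ η, p.eval η = 0 → ∃ s, p = (X - C η) * s ∧ s.eval η ≠ 0 ∧
          0 ≤ q.eval η * s.eval η := by
        intro η hη
        obtain ⟨s, hs, hnd⟩ := p.exists_eq_pow_rootMultiplicity_mul_and_not_dvd hp0 η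
        have hm : p.rootMultiplicity η ≠ 0 := by
          rw [← Nat.pos_iff_ne_zero, rootMultiplicity_pos hp0]; exact hη
        have hsη : s.eval η ≠ 0 := fun h => hnd (dvd_iff_isRoot.mpr h)
        obtain ⟨h1, h2⟩ := simple_root_of_im_nonpos s q η hm (fun w hw => by
          rw [← hs]; exact hIm w hw) hsη (hcom η hη)
        rw [h1, pow_one] at hs
        exact ⟨s, hs, hsη, h2⟩
      have hnodup : p.roots.Nodup := by
        rw [Multiset.nodup_iff_count_le_one]
        intro η
        rw [count_roots]
        by_cases hη : p.eval η = 0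
        · obtain ⟨s, hs, hsη, -⟩ := hloc η hη
          rw [hs, rootMultiplicity_mul (hs ▸ hp0), rootMultiplicity_X_sub_C_self,
            rootMultiplicity_eq_zero hsη]
        · rw [rootMultiplicity_eq_zero hη]; exact zero_le
      have hcard : p.roots.toFinset.card = p.natDegree := by
        rw [Multiset.toFinset_card_of_nodup hnodup, hp.natDegree_eq_card_roots]
      set N := p.roots.toFinset with hN
      have hpn : p = C p.leadingCoeff * Lagrange.nodal N id := by
        conv_lhs => rw [hp.eq_prod_roots]
        rw [Lagrange.nodal, Finset.prod_eq_multiset_prod, hN, Multiset.toFinset_val,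
          hnodup.dedup]
        rfl
      have hl : p.leadingCoeff ≠ 0 := leadingCoeff_ne_zero.mpr hp0
      set c := q.coeff p.natDegree / p.leadingCoeff
      have hr : (q - c • p).degree < N.card := by
        rw [hcard, degree_lt_iff_coeff_zero]
        intro k hk
        rcases hk.eq_or_lt with rfl | hk
        · simp only [coeff_sub, coeff_smul, smul_eq_mul, coeff_natDegree, c]
          rw [div_mul_cancel₀ _ hl, sub_self]
        · have h1 : p.coeff k = 0 := coeff_eq_zero_of_natDegree_lt hk
          have h2 : q.coeff k = 0 :=
            coeff_eq_zero_of_natDegree_lt ((natDegree_le_natDegree hdeg).trans_lt hk)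
          simp [h1, h2]
      have hq : q = c • p + ∑ η ∈ N, C (Lagrange.nodalWeight N id η) *
          (Lagrange.nodal N id / (X - C η)) * C (q.eval η) := by
        have h := Lagrange.eq_interpolate (v := id) (Set.injOn_id _) hr
        rw [Lagrange.interpolate_eq_nodalWeight_mul_nodal_div_X_sub_C] at h
        rw [← sub_eq_iff_eq_add', h]
        refine Finset.sum_congr rfl fun η hη => ?_
        have : p.eval η = 0 := (mem_roots hp0).mp (Multiset.mem_toFinset.mp hη)
        simp [this]
      rw [hq, map_add, map_smul, hLp, smul_zero, zero_add, map_sum]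
      refine Finset.sum_nonpos fun η hη => ?_
      have hpη : p.eval η = 0 := (mem_roots hp0).mp (Multiset.mem_toFinset.mp hη)
      obtain ⟨s, hs, hsη, hsq⟩ := hloc η hpη
      have hdiv : Lagrange.nodal N id / (X - C η) = C p.leadingCoeff⁻¹ * s := by
        have : Lagrange.nodal N id = (X - C η) * (C p.leadingCoeff⁻¹ * s) := by
          rw [mul_left_comm, ← hs]
          conv_rhs => rw [hpn]
          rw [← mul_assoc, ← C_mul, leadingCoeff_mul, leadingCoeff_C]
          simp [(Lagrange.nodal_monic).leadingCoeff, hl]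
        rw [this, mul_div_cancel_left₀ _ (X_sub_C_ne_zero η)]
      have hw : Lagrange.nodalWeight N id η = p.leadingCoeff * (s.eval η)⁻¹ := by
        rw [Lagrange.nodalWeight_eq_eval_derivative_nodal hη]
        have h1 : p.derivative.eval η = s.eval η := by
          conv_lhs => rw [hs]
          simp
        have h2 : p.derivative.eval η =
            p.leadingCoeff * (Lagrange.nodal N id).derivative.eval η := by
          conv_lhs => rw [hpn]
          simp
        rw [← h1, h2]
        simp only [id]
        rw [mul_inv, ← mul_assoc, mul_inv_cancel₀ hl, one_mul]
      have e : C (Lagrange.nodalWeight N id η) * (Lagrange.nodal N id / (X - C η)) *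
          C (q.eval η) = (q.eval η / s.eval η) • s := by
        rw [hdiv, hw, smul_eq_C_mul]
        have : C p.leadingCoeff * C p.leadingCoeff⁻¹ = (1 : ℝ[X]) := by
          rw [← C_mul, mul_inv_cancel₀ hl, C_1]
        rw [div_eq_mul_inv, C_mul, C_mul]
        linear_combination C (s.eval η)⁻¹ * s * C (q.eval η) * this
      rw [e, map_smul, smul_eq_mul]
      refine mul_nonpos_of_nonneg_of_nonpos ?_ (hL η s hs)
      rw [div_eq_mul_inv, ← mul_self_mul_inv (s.eval η)⁻¹, inv_inv]
      have := mul_nonneg hsq (mul_self_nonneg (s.eval η)⁻¹)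
      convert this using 1; ring

open Polynomial in
theorem prod_X_sub_C_laguerre (s : Multiset ℝ) (w : ℝ) (hs : ∀ η ∈ s, η < w) :
    0 < ((s.map fun η => X - C η).prod).eval w ∧
    0 ≤ (derivative (s.map fun η => X - C η).prod).eval w ∧
    (derivative (derivative (s.map fun η => X - C η).prod)).eval w *
      ((s.map fun η => X - C η).prod).eval w ≤
      (derivative (s.map fun η => X - C η).prod).eval w ^ 2 := by
  induction s using Multiset.induction_on with
  | empty => simp
  | cons η s ih =>
    obtain ⟨h0, h1, h2⟩ := ih fun ξ hξ => hs ξ (Multiset.mem_cons_of_mem hξ)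
    have hη : 0 < w - η := sub_pos.mpr (hs η (Multiset.mem_cons_self η s))
    simp only [Multiset.map_cons, Multiset.prod_cons]
    set F := (s.map fun η => X - C η).prod
    simp only [derivative_mul, derivative_sub, derivative_X, derivative_C, sub_zero, one_mul,
      derivative_add, eval_add, eval_mul, eval_sub, eval_X, eval_C]
    refine ⟨by positivity, by positivity, ?_⟩
    nlinarith [mul_le_mul_of_nonneg_left h2 (sq_nonneg (w - η)), sq_nonneg (F.eval w)]

open Polynomial in
theorem splits_laguerre (p : ℝ[X]) (hp : p.Splits) (w : ℝ) (hroots : ∀ η ∈ p.roots, η < w)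
    (hw : 0 < p.eval w) :
    0 ≤ (derivative p).eval w ∧
    (derivative (derivative p)).eval w * p.eval w ≤ (derivative p).eval w ^ 2 := by
  obtain ⟨h0, h1, h2⟩ := prod_X_sub_C_laguerre p.roots w hroots
  have e := hp.eq_prod_roots
  set F := (p.roots.map fun η => X - C η).prod
  set l := p.leadingCoeff
  rw [e] at hw ⊢
  simp only [derivative_mul, derivative_C, zero_mul, zero_add, eval_mul, eval_C] at hw ⊢
  have hl : 0 < l := pos_of_mul_pos_left hw h0.le
  refine ⟨by positivity, ?_⟩
  nlinarith [mul_le_mul_of_nonneg_left h2 (sq_nonneg l)]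

open Polynomial in
/-- The operator `1 - ½ d²/dX²` on real univariate polynomials. -/
noncomputable def oneSubHalfDeriv : ℝ[X] →ₗ[ℝ] ℝ[X] :=
  LinearMap.id - (1 / 2 : ℝ) • (derivative ∘ₗ derivative)

open Polynomial in
theorem eval_oneSubHalfDeriv (p : ℝ[X]) (w : ℝ) :
    (oneSubHalfDeriv p).eval w = p.eval w - (derivative (derivative p)).eval w / 2 := by
  simp [oneSubHalfDeriv]; ring

open Polynomial in
theorem eval_oneSubHalfDeriv_pos (p : ℝ[X]) (hp : p.Splits) {w φ : ℝ} (hφ : φ ^ 2 < 2)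
    (hroots : ∀ η ∈ p.roots, η < w) (hw : 0 < p.eval w)
    (hφp : (derivative p).eval w ≤ φ * p.eval w) : 0 < (oneSubHalfDeriv p).eval w := by
  obtain ⟨h1, h2⟩ := splits_laguerre p hp w hroots hw
  rw [eval_oneSubHalfDeriv]
  have h3 : (derivative p).eval w ^ 2 ≤ (φ * p.eval w) ^ 2 := pow_le_pow_left₀ h1 hφp 2
  have h4 : (derivative (derivative p)).eval w ≤ φ ^ 2 * p.eval w :=
    le_of_mul_le_mul_right (by nlinarith) hw
  nlinarith

open Polynomial in
/-- The univariate barrier shift: replacing `p`, `q` by their images under `1 - ½ d²/dX²`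
and moving from `y` to `y + δ` does not increase the ratio `q / p`. -/
theorem oneSubHalfDeriv_barrier (p q : ℝ[X]) (hp : p.Splits) {y δ φ : ℝ} (hδ : 0 ≤ δ)
    (hφδ : φ + δ * φ ^ 2 / 2 ≤ δ) (hpos : ∀ w, y ≤ w → 0 < p.eval w)
    (hφp : (derivative p).eval (y + δ) ≤ φ * p.eval (y + δ)) (hdeg : q.degree ≤ p.degree)
    (hIm : ∀ w : ℂ, 0 < w.im → (aeval w q * starRingEnd ℂ (aeval w p)).im ≤ 0) :
    (oneSubHalfDeriv q).eval (y + δ) * p.eval y ≤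
      q.eval y * (oneSubHalfDeriv p).eval (y + δ) := by
  have hp0 : p ≠ 0 := by rintro rfl; simpa using hpos y le_rfl
  set w := y + δ with hw
  let L : ℝ[X] →ₗ[ℝ] ℝ := p.eval y • (leval w ∘ₗ oneSubHalfDeriv) -
    (oneSubHalfDeriv p).eval w • leval y
  have hLdef : ∀ g, L g = p.eval y * (oneSubHalfDeriv g).eval w -
    (oneSubHalfDeriv p).eval w * g.eval y := fun g => by simp [L]
  have key : L q ≤ 0 := by
    refine linear_nonpos_of_im_nonpos p q hp0 hp hdeg hIm L (by rw [hLdef]; ring) ?_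
    intro η s hs
    have hη : η < y := by
      by_contra h
      have := hpos η (not_lt.mp h)
      rw [hs] at this
      simp at this
    have hs0 : s ≠ 0 := by rintro rfl; simp [hs] at hp0
    have hpw := hpos w (by linarith)
    have hu : 0 < w - η := by linarith
    have hpw' : p.eval w = (w - η) * s.eval w := by rw [hs]; simp
    have hpy' : p.eval y = (y - η) * s.eval y := by rw [hs]; simp
    have hsw : 0 < s.eval w := by rw [hpw'] at hpw; exact pos_of_mul_pos_right hpw hu.le
    have hsy : 0 < s.eval y := by
      have := hpos y le_rfl
      rw [hpy'] at this; exact pos_of_mul_pos_right this (by linarith)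
    have hsr : ∀ ξ ∈ s.roots, ξ < w := by
      intro ξ hξ
      by_contra h
      have := hpos ξ (by linarith [not_lt.mp h])
      rw [hs, eval_mul, (mem_roots hs0).mp hξ, mul_zero] at this
      exact lt_irrefl _ this
    obtain ⟨h1, h2⟩ := splits_laguerre s (hp.of_dvd hp0 ⟨X - C η, by rw [hs, mul_comm]⟩) w hsr hsw
    have hp' : (derivative p).eval w = s.eval w + (w - η) * (derivative s).eval w := by
      rw [hs]; simp
    have hp'' : (derivative (derivative p)).eval w =
        2 * (derivative s).eval w + (w - η) * (derivative (derivative s)).eval w := by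
      rw [hs]; simp; ring
    have h3 : (derivative s).eval w ≤ φ * s.eval w := by
      rw [hp', hpw'] at hφp
      refine le_of_mul_le_mul_left ?_ hu
      nlinarith
    have h4 : (derivative (derivative s)).eval w ≤ φ ^ 2 * s.eval w := by
      have := pow_le_pow_left₀ h1 h3 2
      exact le_of_mul_le_mul_right (by nlinarith) hsw
    rw [hLdef, hpy', eval_oneSubHalfDeriv, eval_oneSubHalfDeriv, hp'', hpw']
    have h5 : (derivative s).eval w + δ * (derivative (derivative s)).eval w / 2 ≤
        δ * s.eval w := by
      nlinarith [mul_le_mul_of_nonneg_left h4 hδ, mul_le_mul_of_nonneg_right hφδ hsw.le]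
    have e : (y - η) * s.eval y * (s.eval w - (derivative (derivative s)).eval w / 2) -
        ((w - η) * s.eval w - (2 * (derivative s).eval w +
          (w - η) * (derivative (derivative s)).eval w) / 2) * s.eval y =
        s.eval y * ((derivative s).eval w + δ * (derivative (derivative s)).eval w / 2 -
          δ * s.eval w) := by rw [hw]; ring
    rw [e]
    exact mul_nonpos_of_nonneg_of_nonpos hsy.le (by linarith)
  rw [hLdef] at key
  linarith

open Polynomial in
theorem degree_le_of_eval_bounds (p q : ℝ[X]) (y φ : ℝ) (hp : ∀ w, y ≤ w → 0 < p.eval w)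
    (hq0 : ∀ w, y ≤ w → 0 ≤ q.eval w) (hq : ∀ w, y ≤ w → q.eval w ≤ φ * p.eval w) :
    q.degree ≤ p.degree := by
  by_contra h
  have hp0 : p ≠ 0 := by rintro rfl; simpa using hp y le_rfl
  have ht := abs_div_tendsto_atTop_atTop_of_degree_gt q p (not_le.mp h) hp0
  obtain ⟨w, hw1, hw2⟩ := ((ht.eventually_gt_atTop φ).and (Filter.eventually_ge_atTop y)).exists
  rw [abs_of_nonneg (div_nonneg (hq0 w hw2) (hp w hw2).le), lt_div_iff₀ (hp w hw2)] at hw1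
  exact (hq w hw2).not_gt hw1

open Polynomial in
theorem im_sum_inv_sub_roots_neg (s : Multiset ℂ) (w : ℂ) (hs : ∀ ρ ∈ s, ρ.im < w.im) :
    ((s.map fun ρ => 1 / (w - ρ)).sum).im ≤ 0 ∧
      (((s.map fun ρ => 1 / (w - ρ)).sum).im = 0 → s = 0) := by
  induction s using Multiset.induction_on with
  | empty => simp
  | cons ρ s ih =>
    obtain ⟨h, -⟩ := ih fun ξ hξ => hs ξ (Multiset.mem_cons_of_mem hξ)
    have hρ := hs ρ (Multiset.mem_cons_self ρ s)
    have : (1 / (w - ρ)).im < 0 := by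
      rw [one_div, Complex.inv_im, neg_div]
      have h0 : 0 < (w - ρ).im := by simpa using hρ
      have : w - ρ ≠ 0 := by intro h1; simp [h1] at h0
      exact neg_neg_of_pos (div_pos h0 (Complex.normSq_pos.mpr this))
    simp only [Multiset.map_cons, Multiset.sum_cons, Complex.add_im]
    exact ⟨by linarith, fun h' => by linarith⟩

open Polynomial in
theorem roots_im_lt (p : ℂ[X]) (hp : ∀ w : ℂ, 0 < w.im → p.eval w ≠ 0) {w : ℂ} (hw : 0 < w.im) :
    ∀ ρ ∈ p.roots, ρ.im < w.im := by
  intro ρ hρ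
  by_contra h
  exact hp ρ (by linarith) (isRoot_of_mem_roots hρ)

open Polynomial in
theorem im_derivative_mul_conj_nonpos (p : ℂ[X]) (hp : ∀ w : ℂ, 0 < w.im → p.eval w ≠ 0)
    {w : ℂ} (hw : 0 < w.im) :
    ((derivative p).eval w * starRingEnd ℂ (p.eval w)).im ≤ 0 := by
  rw [(IsAlgClosed.splits p).eval_derivative_eq_eval_mul_sum (hp w hw), mul_right_comm,
    Complex.mul_conj, Complex.im_ofReal_mul]
  exact mul_nonpos_of_nonneg_of_nonpos (Complex.normSq_nonneg _)
    (im_sum_inv_sub_roots_neg p.roots w (roots_im_lt p hp hw)).1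

open Polynomial in
theorem eval_add_smul_derivative_ne_zero (p : ℂ[X])
    (hp : ∀ w : ℂ, 0 < w.im → p.eval w ≠ 0) (c : ℝ) {w : ℂ} (hw : 0 < w.im) :
    (p + (c : ℂ) • derivative p).eval w ≠ 0 := by
  intro h
  obtain ⟨-, h2⟩ := im_sum_inv_sub_roots_neg p.roots w (roots_im_lt p hp hw)
  rw [eval_add, eval_smul, smul_eq_mul,
    (IsAlgClosed.splits p).eval_derivative_eq_eval_mul_sum (hp w hw)] at h
  set s := (p.roots.map fun ρ => 1 / (w - ρ)).sum with hsdef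
  have h3 : 1 + (c : ℂ) * s = 0 :=
    (mul_eq_zero.mp (by linear_combination h : p.eval w * (1 + (c : ℂ) * s) = 0)).resolve_left
      (hp w hw)
  have hc : c ≠ 0 := by rintro rfl; simp at h3
  have h4 : c * s.im = 0 := by simpa using congrArg Complex.im h3
  have h5 := h2 ((mul_eq_zero.mp h4).resolve_left hc)
  rw [hsdef, h5] at h3
  simp at h3

open Polynomial in
theorem norm_eval_mono_of_ne_zero (p : ℂ[X]) (hp : ∀ w : ℂ, 0 < w.im → p.eval w ≠ 0)
    {a s t : ℝ} (hs : 0 < s) (hst : s ≤ t) :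
    ‖p.eval ⟨a, s⟩‖ ≤ ‖p.eval ⟨a, t⟩‖ := by
  rw [(IsAlgClosed.splits p).eval_eq_prod_roots, (IsAlgClosed.splits p).eval_eq_prod_roots,
    norm_mul, norm_mul]
  refine mul_le_mul_of_nonneg_left ?_ (norm_nonneg _)
  have h := roots_im_lt p hp (w := ⟨a, s⟩) hs
  generalize p.roots = m at h ⊢
  induction m using Multiset.induction_on with
  | empty => simp
  | cons ρ m ih =>
    simp only [Multiset.map_cons, Multiset.prod_cons, norm_mul]
    refine mul_le_mul ?_ (ih fun ξ hξ => h ξ (Multiset.mem_cons_of_mem hξ)) (norm_nonneg _)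
      (norm_nonneg _)
    have hρ : ρ.im < s := h ρ (Multiset.mem_cons_self ρ m)
    rw [Complex.norm_def, Complex.norm_def]
    refine Real.sqrt_le_sqrt ?_
    simp only [Complex.normSq_apply, Complex.sub_re, Complex.sub_im]
    nlinarith

open Polynomial in
/-- The restriction of a multivariate polynomial to the line through `z` in direction `i`. -/
noncomputable def lineRestrict {σ R A : Type*} [DecidableEq σ] [CommRing R] [CommRing A]
    [Algebra R A] (i : σ) (z : σ → A) : MvPolynomial σ R →ₐ[R] A[X] :=
  MvPolynomial.aeval (Function.update (fun k => C (z k)) i X)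

open Polynomial in
theorem eval_lineRestrict {σ R A : Type*} [DecidableEq σ] [CommRing R] [CommRing A]
    [Algebra R A] (i : σ) (z : σ → A) (w : A) (P : MvPolynomial σ R) :
    (lineRestrict i z P).eval w = MvPolynomial.aeval (Function.update z i w) P := by
  induction P using MvPolynomial.induction_on with
  | C a => simp [lineRestrict, Polynomial.algebraMap_apply]
  | add p q hp hq => simp [hp, hq]
  | mul_X p k hp =>
    rw [map_mul, map_mul, eval_mul, hp]
    by_cases hk : k = i
    · subst hk; simp [lineRestrict]
    · simp [lineRestrict, hk]

open Polynomial in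
theorem aeval_lineRestrict {σ R A B : Type*} [DecidableEq σ] [CommRing R] [CommRing A]
    [CommRing B] [Algebra R A] [Algebra A B] [Algebra R B] [IsScalarTower R A B] (i : σ)
    (z : σ → A) (w : B) (P : MvPolynomial σ R) :
    aeval w (lineRestrict i z P) =
      MvPolynomial.aeval (Function.update (fun k => algebraMap A B (z k)) i w) P := by
  induction P using MvPolynomial.induction_on with
  | C a => simp [lineRestrict, Polynomial.algebraMap_apply, ← IsScalarTower.algebraMap_apply]
  | add p q hp hq => simp [hp, hq]
  | mul_X p k hp =>
    rw [map_mul, map_mul, map_mul, hp]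
    by_cases hk : k = i
    · subst hk; simp [lineRestrict]
    · simp [lineRestrict, hk]

open Polynomial in
theorem derivative_lineRestrict {σ R A : Type*} [DecidableEq σ] [CommRing R] [CommRing A]
    [Algebra R A] (i : σ) (z : σ → A) (P : MvPolynomial σ R) :
    derivative (lineRestrict i z P) = lineRestrict i z (MvPolynomial.pderiv i P) := by
  induction P using MvPolynomial.induction_on with
  | C a => simp [lineRestrict, Polynomial.algebraMap_apply]
  | add p q hp hq => simp [hp, hq]
  | mul_X p k hp =>
    rw [map_mul, derivative_mul, hp, MvPolynomial.pderiv_mul, map_add, map_mul, map_mul]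
    congr 2
    by_cases hk : k = i
    · subst hk; simp [lineRestrict]
    · simp [lineRestrict, hk, MvPolynomial.pderiv_X_of_ne hk]

theorem pderiv_comm {σ R : Type*} [CommRing R] (i j : σ) (P : MvPolynomial σ R) :
    MvPolynomial.pderiv i (MvPolynomial.pderiv j P) =
      MvPolynomial.pderiv j (MvPolynomial.pderiv i P) := by
  classical
  induction P using MvPolynomial.induction_on with
  | C a => simp
  | add p q hp hq => simp [hp, hq]
  | mul_X p k hp =>
    simp only [MvPolynomial.pderiv_mul, MvPolynomial.pderiv_X, map_add, hp]
    have h : ∀ a b : σ, MvPolynomial.pderiv a (Pi.single (M := fun _ => MvPolynomial σ R) b 1 k) =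
        0 := fun a b => by
      rw [Pi.single_apply]; split_ifs <;> simp
    rw [h, h]
    ring

/-- The operator `1 - ½ ∂ᵢ²` on multivariate polynomials. -/
noncomputable def oneSubHalfPderiv {σ : Type*} (K : Type*) [Field K] (i : σ) :
    Module.End K (MvPolynomial σ K) :=
  1 - (1 / 2 : K) • ((MvPolynomial.pderiv i).toLinearMap ∘ₗ (MvPolynomial.pderiv i).toLinearMap)

theorem oneSubHalfPderiv_apply {σ K : Type*} [Field K] (i : σ) (P : MvPolynomial σ K) :
    oneSubHalfPderiv K i P =
      P - (1 / 2 : K) • MvPolynomial.pderiv i (MvPolynomial.pderiv i P) := rfl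

theorem pderiv_oneSubHalfPderiv {σ K : Type*} [Field K] (i j : σ) (P : MvPolynomial σ K) :
    MvPolynomial.pderiv j (oneSubHalfPderiv K i P) =
      oneSubHalfPderiv K i (MvPolynomial.pderiv j P) := by
  simp only [oneSubHalfPderiv_apply, map_sub, Derivation.map_smul]
  rw [pderiv_comm j i, pderiv_comm j i]

open Polynomial in
theorem lineRestrict_oneSubHalfPderiv {σ : Type*} [DecidableEq σ] (i : σ) (z : σ → ℝ)
    (P : MvPolynomial σ ℝ) :
    lineRestrict i z (oneSubHalfPderiv ℝ i P) = oneSubHalfDeriv (lineRestrict i z P) := by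
  simp [oneSubHalfPderiv_apply, oneSubHalfDeriv, derivative_lineRestrict]

/-- A real polynomial is stable if it has no zeros with all coordinates in the open upper half
plane. -/
def RealStable {σ : Type*} (P : MvPolynomial σ ℝ) : Prop :=
  ∀ z : σ → ℂ, (∀ k, 0 < (z k).im) → MvPolynomial.aeval z P ≠ 0

theorem update_im_pos {σ : Type*} [DecidableEq σ] {z : σ → ℂ} (hz : ∀ k, 0 < (z k).im) (i : σ)
    {w : ℂ} (hw : 0 < w.im) (k : σ) : 0 < (Function.update z i w k).im := by
  by_cases hk : k = i
  · subst hk; simpa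
  · simpa [hk] using hz k

theorem RealStable.eval_lineRestrict_ne_zero {σ : Type*} [DecidableEq σ] {P : MvPolynomial σ ℝ}
    (hP : RealStable P) (i : σ) {z : σ → ℂ} (hz : ∀ k, 0 < (z k).im) (w : ℂ) (hw : 0 < w.im) :
    (lineRestrict i z P).eval w ≠ 0 := by
  rw [eval_lineRestrict]
  exact hP _ (update_im_pos hz i hw)

open Polynomial in
theorem RealStable.oneSubHalfPderiv {σ : Type*} {P : MvPolynomial σ ℝ} (hP : RealStable P)
    (i : σ) : RealStable (oneSubHalfPderiv ℝ i P) := by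
  classical
  intro z hz
  set p := lineRestrict i z P with hp
  have h0 := hP.eval_lineRestrict_ne_zero i hz
  set c : ℝ := √(1 / 2)
  have hc : (c : ℂ) * c = 1 / 2 := by
    rw [← Complex.ofReal_mul, Real.mul_self_sqrt (by norm_num)]; norm_num
  have h1 := fun w => eval_add_smul_derivative_ne_zero p h0 c (w := w)
  have h2 := eval_add_smul_derivative_ne_zero _ h1 (-c) (hz i)
  have e : MvPolynomial.aeval z (_root_.oneSubHalfPderiv ℝ i P) =
      (lineRestrict i z (_root_.oneSubHalfPderiv ℝ i P)).eval (z i) := by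
    rw [eval_lineRestrict, Function.update_eq_self]
  rw [e]
  convert h2 using 1
  simp only [oneSubHalfPderiv_apply, map_sub, map_smul, ← derivative_lineRestrict, ← hp,
    derivative_add, eval_add, eval_sub, eval_smul, smul_eq_mul,
    Complex.ofReal_neg, Complex.real_smul, Complex.ofReal_div, Complex.ofReal_one,
    Complex.ofReal_ofNat]
  linear_combination (derivative (derivative p)).eval (z i) * hc

theorem tendsto_aeval_add_mul_I {σ : Type*} (z : σ → ℂ) (P : MvPolynomial σ ℝ) :
    Filter.Tendsto (fun ε : ℝ => MvPolynomial.aeval (fun k => z k + ε * Complex.I) P)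
      (nhdsWithin 0 (Set.Ioi 0)) (nhds (MvPolynomial.aeval z P)) := by
  have hc : Continuous fun ε : ℝ => MvPolynomial.aeval (fun k => z k + ε * Complex.I) P := by
    simp only [MvPolynomial.aeval_def, MvPolynomial.eval₂_eq_eval_map]
    exact (MvPolynomial.continuous_eval _).comp (by fun_prop)
  simpa using (hc.tendsto 0).mono_left nhdsWithin_le_nhds

theorem RealStable.im_pderiv_mul_conj_nonpos {σ : Type*} {P : MvPolynomial σ ℝ}
    (hP : RealStable P) (j : σ) {z : σ → ℂ} (hz : ∀ k, 0 ≤ (z k).im) :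
    (MvPolynomial.aeval z (MvPolynomial.pderiv j P) *
      starRingEnd ℂ (MvPolynomial.aeval z P)).im ≤ 0 := by
  classical
  have ht := (tendsto_aeval_add_mul_I z (MvPolynomial.pderiv j P)).mul
    ((Complex.continuous_conj.tendsto _).comp (tendsto_aeval_add_mul_I z P))
  refine le_of_tendsto ((Complex.continuous_im.tendsto _).comp ht) ?_
  filter_upwards [self_mem_nhdsWithin] with ε hε
  have hz' : ∀ k, 0 < (z k + ε * Complex.I).im := fun k => by
    simpa using add_pos_of_nonneg_of_pos (hz k) hε
  have := im_derivative_mul_conj_nonpos _ (hP.eval_lineRestrict_ne_zero j hz') (hz' j)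
  rw [derivative_lineRestrict, eval_lineRestrict, eval_lineRestrict,
    Function.update_eq_self] at this
  exact this

theorem RealStable.norm_aeval_mono {σ : Type*} [DecidableEq σ] {P : MvPolynomial σ ℝ}
    (hP : RealStable P) (i : σ) (z : σ → ℝ) {a s t : ℝ} (hs : 0 < s) (hst : s ≤ t) :
    ‖MvPolynomial.aeval (Function.update (fun k => (z k : ℂ)) i ⟨a, s⟩) P‖ ≤
      ‖MvPolynomial.aeval (Function.update (fun k => (z k : ℂ)) i ⟨a, t⟩) P‖ := by
  refine le_of_tendsto_of_tendsto (tendsto_aeval_add_mul_I _ P).norm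
    (tendsto_aeval_add_mul_I _ P).norm ?_
  filter_upwards [self_mem_nhdsWithin] with ε hε
  have hε' : (0 : ℝ) < ε := hε
  have hz' : ∀ k, 0 < ((z k : ℂ) + ε * Complex.I).im := fun k => by simpa using hε'
  have := norm_eval_mono_of_ne_zero _ (hP.eval_lineRestrict_ne_zero i hz') (a := a)
    (add_pos hs hε') (add_le_add_left hst ε)
  rw [eval_lineRestrict, eval_lineRestrict] at this
  have e : ∀ b : ℝ, Function.update (fun k => (z k : ℂ) + ε * Complex.I) i ⟨a, b + ε⟩ =
      fun k => Function.update (fun k => (z k : ℂ)) i ⟨a, b⟩ k + ε * Complex.I := by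
    intro b
    ext k
    by_cases hk : k = i
    · subst hk; simp [Complex.ext_iff]
    · simp [hk]
  rwa [e, e] at this

open Polynomial in
theorem RealStable.splits_lineRestrict {σ : Type*} [DecidableEq σ] {P : MvPolynomial σ ℝ}
    (hP : RealStable P) (i : σ) (z : σ → ℝ) : (lineRestrict i z P).Splits := by
  set p := lineRestrict i z P with hp
  by_cases hp0 : p = 0
  · rw [hp0]; exact Splits.zero
  have hpC : p.map (algebraMap ℝ ℂ) ≠ 0 := Polynomial.map_ne_zero hp0
  have hup : ∀ w : ℂ, 0 < w.im → aeval w p ≠ 0 := by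
    intro w hw h
    have hsub : (fun s : ℝ => (⟨w.re, s⟩ : ℂ)) '' Set.Ioc 0 w.im ⊆
        {x | (p.map (algebraMap ℝ ℂ)).IsRoot x} := by
      rintro _ ⟨s, hs, rfl⟩
      have := hP.norm_aeval_mono i z (a := w.re) hs.1 hs.2
      have e := aeval_lineRestrict (B := ℂ) i z w P
      have e' := aeval_lineRestrict (B := ℂ) i z ⟨w.re, s⟩ P
      simp only [Complex.coe_algebraMap] at e e'
      rw [← e', Complex.eta, ← e, ← hp, h, norm_zero, norm_le_zero_iff] at this
      rwa [Set.mem_ofPred_eq, IsRoot, eval_map_algebraMap]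
    refine hpC (eq_zero_of_infinite_isRoot _ (Set.Infinite.mono hsub ?_))
    exact (Set.Ioc_infinite hw).image fun a _ b _ hab => congrArg Complex.im hab
  refine Splits.of_splits_map (algebraMap ℝ ℂ) (IsAlgClosed.splits _) fun ρ hρ => ?_
  have hρ0 : aeval ρ p = 0 := by
    rw [← eval_map_algebraMap]; exact isRoot_of_mem_roots hρ
  have h1 : ρ.im ≤ 0 := not_lt.mp fun h => hup ρ h hρ0
  have h2 : 0 ≤ ρ.im := by
    refine not_lt.mp fun h => hup (starRingEnd ℂ ρ) (by simpa using h) ?_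
    rw [aeval_conj, hρ0, map_zero]
  exact ⟨ρ.re, Complex.ext (by simp) (by simp [le_antisymm h1 h2])⟩

/-- At every point `≥ z`, the polynomial `P` is positive and its logarithmic derivatives in the
directions `j ∈ J` are at most `φ j`. -/
def BarrierBound {σ : Type*} (P : MvPolynomial σ ℝ) (J : Set σ) (φ z : σ → ℝ) : Prop :=
  ∀ y, z ≤ y → 0 < MvPolynomial.aeval y P ∧
    ∀ j ∈ J, MvPolynomial.aeval y (MvPolynomial.pderiv j P) ≤ φ j * MvPolynomial.aeval y P

theorem RealStable.pderiv_nonneg {σ : Type*} {P : MvPolynomial σ ℝ} (hP : RealStable P)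
    {z : σ → ℝ} (hpos : ∀ y, z ≤ y → 0 < MvPolynomial.aeval y P) (j : σ) {y : σ → ℝ}
    (hy : z ≤ y) : 0 ≤ MvPolynomial.aeval y (MvPolynomial.pderiv j P) := by
  classical
  have hline : ∀ w, y j ≤ w → 0 < (lineRestrict j y P).eval w := by
    intro w hw
    rw [eval_lineRestrict]
    exact hpos _ (hy.trans (le_update_iff.mpr ⟨hw, fun _ _ => le_rfl⟩))
  have := (splits_laguerre (lineRestrict j y P) (hP.splits_lineRestrict j y) (y j)
    (fun η hη => not_le.mp fun h =>
      (hline η h).ne' (Polynomial.isRoot_of_mem_roots hη)) (hline _ le_rfl)).1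
  rwa [derivative_lineRestrict, eval_lineRestrict, Function.update_eq_self] at this

theorem BarrierBound.oneSubHalfPderiv {σ : Type*} [DecidableEq σ] {P : MvPolynomial σ ℝ}
    (hP : RealStable P) {J : Set σ} {φ z : σ → ℝ} (h : BarrierBound P J φ z) {i : σ} (hi : i ∈ J)
    {δ : ℝ} (hδ : 0 ≤ δ) (hφδ : φ i + δ * φ i ^ 2 / 2 ≤ δ) (hφ : φ i ^ 2 < 2) :
    BarrierBound (oneSubHalfPderiv ℝ i P) J φ (Function.update z i (z i + δ)) := by
  intro x hx
  set y := Function.update x i (x i - δ) with hy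
  have hxy : Function.update y i (y i + δ) = x := by simp [hy]
  have hzy : z ≤ y := by
    intro k
    by_cases hk : k = i
    · subst hk
      have := hx k
      simp only [Function.update_self] at this
      simp only [hy, Function.update_self]
      linarith
    · simpa [hy, hk] using hx k
  have hup : ∀ w, y i ≤ w → z ≤ Function.update y i w := fun w hw =>
    hzy.trans (le_update_iff.mpr ⟨hw, fun _ _ => le_rfl⟩)
  set p := lineRestrict i y P with hp
  have hsplit : p.Splits := hP.splits_lineRestrict i y
  have hpos : ∀ w, y i ≤ w → 0 < p.eval w := fun w hw => by
    rw [hp, eval_lineRestrict]; exact (h _ (hup w hw)).1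
  have hφp : (Polynomial.derivative p).eval (y i + δ) ≤ φ i * p.eval (y i + δ) := by
    rw [hp, derivative_lineRestrict, eval_lineRestrict, eval_lineRestrict]
    exact (h _ (hup _ (by linarith))).2 i hi
  have hev : ∀ G : MvPolynomial σ ℝ, MvPolynomial.aeval x (_root_.oneSubHalfPderiv ℝ i G) =
      (oneSubHalfDeriv (lineRestrict i y G)).eval (y i + δ) := fun G => by
    rw [← lineRestrict_oneSubHalfPderiv, eval_lineRestrict, hxy]
  have hT : 0 < (oneSubHalfDeriv p).eval (y i + δ) :=
    eval_oneSubHalfDeriv_pos p hsplit hφ (fun η hη => not_le.mp fun hle =>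
      (hpos η (by linarith)).ne' (Polynomial.isRoot_of_mem_roots hη)) (hpos _ (by linarith)) hφp
  refine ⟨by rwa [hev], fun j hj => ?_⟩
  rw [pderiv_oneSubHalfPderiv, hev, hev]
  set q := lineRestrict i y (MvPolynomial.pderiv j P) with hq
  have hqp : ∀ w, y i ≤ w → q.eval w ≤ φ j * p.eval w := fun w hw => by
    rw [hq, hp, eval_lineRestrict, eval_lineRestrict]
    exact (h _ (hup w hw)).2 j hj
  have hdeg : q.degree ≤ p.degree := degree_le_of_eval_bounds p q (y i) (φ j) hpos
    (fun w hw => by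
      rw [hq, eval_lineRestrict]
      exact hP.pderiv_nonneg (fun y hy => (h y hy).1) j (hup w hw)) hqp
  have key := oneSubHalfDeriv_barrier p q hsplit hδ hφδ hpos hφp hdeg (fun w hw => by
    rw [hp, hq, aeval_lineRestrict, aeval_lineRestrict]
    refine hP.im_pderiv_mul_conj_nonpos j fun k => ?_
    by_cases hk : k = i
    · subst hk; simpa using hw.le
    · simp [hk])
  have hy0 := hpos _ le_rfl
  refine le_of_mul_le_mul_right (key.trans ?_) hy0
  calc q.eval (y i) * _ ≤ (φ j * p.eval (y i)) * _ :=
        mul_le_mul_of_nonneg_right (hqp _ le_rfl) hT.le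
    _ = _ := by ring

theorem BarrierBound.prod_oneSubHalfPderiv {σ : Type*} [DecidableEq σ] {P : MvPolynomial σ ℝ}
    (hP : RealStable P) {J : Set σ} {φ δ z : σ → ℝ} (h : BarrierBound P J φ z)
    (hδ : ∀ i ∈ J, 0 ≤ δ i) (hφδ : ∀ i ∈ J, φ i + δ i * φ i ^ 2 / 2 ≤ δ i)
    (hφ : ∀ i ∈ J, φ i ^ 2 < 2) (l : List σ) (hl : ∀ i ∈ l, i ∈ J) :
    RealStable ((l.map (_root_.oneSubHalfPderiv ℝ)).prod P) ∧
    BarrierBound ((l.map (_root_.oneSubHalfPderiv ℝ)).prod P) J φ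
      (fun k => z k + l.count k * δ k) := by
  induction l with
  | nil => simpa using ⟨hP, h⟩
  | cons i l ih =>
    obtain ⟨h1, h2⟩ := ih fun k hk => hl k (List.mem_cons_of_mem i hk)
    have hi : i ∈ J := hl i List.mem_cons_self
    rw [List.map_cons, List.prod_cons, Module.End.mul_apply]
    refine ⟨h1.oneSubHalfPderiv i, ?_⟩
    convert h2.oneSubHalfPderiv h1 hi (hδ i hi) (hφδ i hi) (hφ i hi) using 1
    ext k
    by_cases hk : k = i
    · subst hk; simp; ring
    · simp [hk, Ne.symm hk]

section DetPencil

variable {τ : Type*} {m d : ℕ}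

/-- The polynomial `det (X₀ I + ∑ X_{v i} B i)`. -/
noncomputable def detPencil (B : Fin m → Matrix (Fin d) (Fin d) ℂ) (o : τ) (v : Fin m → τ) :
    MvPolynomial τ ℂ :=
  Matrix.det (Matrix.of fun a b =>
    MvPolynomial.X o * (if a = b then 1 else 0) +
      ∑ i, MvPolynomial.X (v i) * MvPolynomial.C (B i a b))

/-- The matrix `y₀ I + ∑ y_{v i} B i`. -/
noncomputable def pencil (B : Fin m → Matrix (Fin d) (Fin d) ℂ) (o : τ) (v : Fin m → τ)
    (y : τ → ℂ) : Matrix (Fin d) (Fin d) ℂ :=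
  y o • (1 : Matrix (Fin d) (Fin d) ℂ) + ∑ i, y (v i) • B i

theorem eval_detPencil (B : Fin m → Matrix (Fin d) (Fin d) ℂ) (o : τ) (v : Fin m → τ)
    (y : τ → ℂ) : MvPolynomial.eval y (detPencil B o v) = (pencil B o v y).det := by
  rw [detPencil, RingHom.map_det]
  congr 1
  ext a b
  simp [pencil, Matrix.sum_apply, Matrix.one_apply, apply_ite]

theorem rename_detPencil {τ' : Type*} (B : Fin m → Matrix (Fin d) (Fin d) ℂ) (o : τ)
    (v : Fin m → τ) (f : τ → τ') :
    MvPolynomial.rename f (detPencil B o v) = detPencil B (f o) (f ∘ v) := by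
  rw [detPencil, AlgHom.map_det, detPencil]
  congr 1
  ext1 a b
  simp [apply_ite]

theorem exists_real_detPencil (B : Fin m → Matrix (Fin d) (Fin d) ℂ)
    (hB : ∀ i, (B i).IsHermitian) (o : τ) (v : Fin m → τ) :
    ∃ R : MvPolynomial τ ℝ, MvPolynomial.map Complex.ofRealHom R = detPencil B o v := by
  have hstar : MvPolynomial.map (starRingEnd ℂ) (detPencil B o v) = detPencil B o v := by
    rw [detPencil, RingHom.map_det, ← Matrix.det_transpose]
    congr 1
    ext1 a b
    have h : ∀ i, starRingEnd ℂ (B i b a) = B i a b := fun i => (hB i).apply a b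
    simp [apply_ite, h, eq_comm]
  have hmem : detPencil B o v ∈ Set.range (MvPolynomial.map (σ := τ) Complex.ofRealHom) := by
    rw [MvPolynomial.mem_range_map_iff_coeffs_subset]
    intro c hc
    obtain ⟨k, -, rfl⟩ := MvPolynomial.mem_coeffs_iff.mp hc
    have := congrArg (MvPolynomial.coeff k) hstar
    rw [MvPolynomial.coeff_map] at this
    obtain ⟨r, hr⟩ := Complex.conj_eq_iff_real.mp this
    exact ⟨r, hr.symm⟩
  exact hmem

theorem pencil_det_ne_zero (B : Fin m → Matrix (Fin d) (Fin d) ℂ)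
    (hB : ∀ i, (B i).PosSemidef) (o : τ) (v : Fin m → τ) (y : τ → ℂ)
    (hy : ∀ k, 0 < (y k).im) : (pencil B o v y).det ≠ 0 := by
  intro h
  obtain ⟨x, hx0, hx⟩ := Matrix.exists_mulVec_eq_zero_iff.mpr h
  have h1 : star x ⬝ᵥ (pencil B o v y).mulVec x = 0 := by rw [hx, dotProduct_zero]
  have h2 : (star x ⬝ᵥ (pencil B o v y).mulVec x) =
      y o * (star x ⬝ᵥ x) + ∑ i, y (v i) * (star x ⬝ᵥ (B i).mulVec x) := by
    simp [pencil, Matrix.add_mulVec, Matrix.smul_mulVec, Matrix.sum_mulVec, dotProduct_add,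
      dotProduct_smul, dotProduct_sum]
  have h3 : 0 < star x ⬝ᵥ x := Matrix.dotProduct_star_self_pos_iff.mpr hx0
  have h4 : ∀ i, 0 ≤ star x ⬝ᵥ (B i).mulVec x := fun i => (hB i).dotProduct_mulVec_nonneg x
  rw [h1] at h2
  have h5 := congrArg Complex.im h2
  have him : ∀ a b : ℂ, 0 ≤ b → (a * b).im = a.im * b.re := fun a b hb => by
    simp [Complex.mul_im, ← (Complex.le_def.mp hb).2]
  rw [Complex.zero_im, Complex.add_im, Complex.im_sum, him _ _ h3.le,
    Finset.sum_congr rfl fun i _ => him _ _ (h4 i)] at h5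
  have h6 : 0 < (y o).im * (star x ⬝ᵥ x).re := mul_pos (hy o) (Complex.lt_def.mp h3).1
  have h7 : 0 ≤ ∑ i, (y (v i)).im * (star x ⬝ᵥ (B i).mulVec x).re :=
    Finset.sum_nonneg fun i _ => mul_nonneg (hy _).le (Complex.le_def.mp (h4 i)).1
  linarith

open Polynomial in
theorem eval_derivative_det_add_X_smul (M N : Matrix (Fin d) (Fin d) ℂ) (hM : M.det ≠ 0) :
    (derivative (M.map C + (X : ℂ[X]) • N.map C).det).eval 0 = M.det * (M⁻¹ * N).trace := by
  have h : M.map C + (X : ℂ[X]) • N.map C = M.map C * (1 + (X : ℂ[X]) • (M⁻¹ * N).map C) := by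
    rw [mul_add, mul_one, Matrix.mul_smul, ← Matrix.map_mul, ← mul_assoc,
      Matrix.mul_nonsing_inv _ (Ne.isUnit hM), one_mul]
  have h' : (M.map (C : ℂ →+* ℂ[X])).det = C M.det := (RingHom.map_det C M).symm
  rw [h, Matrix.det_mul, h', derivative_C_mul, eval_mul, eval_C,
    Matrix.derivative_det_one_add_X_smul]

open Polynomial in
theorem eval_pderiv_detPencil [DecidableEq τ] (B : Fin m → Matrix (Fin d) (Fin d) ℂ) (o : τ)
    (v : Fin m → τ) (j : τ) (hj : j ≠ o) (i : Fin m) (hv : ∀ k, v k = j ↔ k = i) (y : τ → ℂ)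
    (hM : (pencil B o v y).det ≠ 0) :
    MvPolynomial.eval y (MvPolynomial.pderiv j (detPencil B o v)) =
      (pencil B o v y).det * ((pencil B o v y)⁻¹ * B i).trace := by
  rw [← eval_derivative_det_add_X_smul _ _ hM]
  have hpencil : ∀ s, pencil B o v (Function.update y j (s + y j)) =
      pencil B o v y + s • B i := by
    intro s
    have : ∀ k, Function.update y j (s + y j) (v k) • B k =
        y (v k) • B k + if k = i then s • B k else 0 := by
      intro k
      by_cases hk : k = i
      · rw [(hv k).mpr hk]; simp [hk, add_smul, add_comm]
      · have : v k ≠ j := fun h => hk ((hv k).mp h)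
        simp [hk, this]
    simp [pencil, this, Finset.sum_add_distrib, hj.symm, add_assoc]
  have e : (lineRestrict j y (detPencil B o v)).comp (X + C (y j)) =
      ((pencil B o v y).map C + (X : ℂ[X]) • (B i).map C).det := by
    refine funext fun s => ?_
    rw [eval_comp, eval_lineRestrict, ← Polynomial.coe_evalRingHom,
      RingHom.map_det]
    simp only [coe_evalRingHom, eval_add, eval_X, eval_C, MvPolynomial.aeval_eq_eval]
    rw [eval_detPencil, hpencil]
    congr 1
    ext a b
    simp [mul_comm s]
  rw [← e, derivative_comp, derivative_lineRestrict]
  simp [eval_lineRestrict, MvPolynomial.aeval_eq_eval]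

end DetPencil

open scoped Matrix in
theorem trace_inv_mul_le {d : ℕ} {M N : Matrix (Fin d) (Fin d) ℂ}
    (hM : (M - (2 : ℂ) • (1 : Matrix (Fin d) (Fin d) ℂ)).PosSemidef) (hN : N.PosSemidef) :
    M.PosDef ∧ 0 ≤ (1 / 2 : ℂ) * N.trace - (M⁻¹ * N).trace := by
  have hpd : M.PosDef := by
    have h2 : ((2 : ℂ) • (1 : Matrix (Fin d) (Fin d) ℂ)).PosDef :=
      Matrix.PosDef.one.smul (by norm_num)
    simpa using h2.add_posSemidef hM
  refine ⟨hpd, ?_⟩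
  have hu : IsUnit M.det := hpd.det_pos.ne'.isUnit
  have hinv : (M⁻¹)ᴴ = M⁻¹ := hpd.isHermitian.inv
  set K := M⁻¹ with hK
  have hKM : K * M = 1 := Matrix.nonsing_inv_mul _ hu
  have h1 : (K * (M - (2 : ℂ) • (1 : Matrix (Fin d) (Fin d) ℂ)) * K).PosSemidef := by
    have := hM.conjTranspose_mul_mul_same K
    rwa [hinv] at this
  have hT : (1 - (2 : ℂ) • K)ᴴ = 1 - (2 : ℂ) • K := by
    simp [Matrix.conjTranspose_sub, Matrix.conjTranspose_smul, hinv]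
  have h2 : ((1 / 2 : ℂ) • ((1 - (2 : ℂ) • K) * (1 - (2 : ℂ) • K))).PosSemidef := by
    have := Matrix.posSemidef_conjTranspose_mul_self (1 - (2 : ℂ) • K)
    rw [hT] at this
    exact this.smul (by rw [one_div, inv_nonneg]; norm_num)
  have h3 : ((1 / 2 : ℂ) • (1 : Matrix (Fin d) (Fin d) ℂ) - K).PosSemidef := by
    convert h1.add h2 using 1
    rw [mul_sub, sub_mul, hKM]
    simp only [mul_sub, sub_mul, one_mul, mul_one, Matrix.mul_smul, Matrix.smul_mul, smul_sub,
      smul_smul]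
    module
  obtain ⟨R, rfl⟩ : ∃ R, N = Rᴴ * R := by
    open scoped MatrixOrder in exact CStarAlgebra.nonneg_iff_eq_star_mul_self.mp hN.nonneg
  have h4 := (h3.mul_mul_conjTranspose_same R).trace_nonneg
  convert h4 using 1
  rw [Matrix.mul_sub, Matrix.sub_mul, Matrix.trace_sub, Matrix.trace_mul_comm (R * K),
    Matrix.trace_mul_comm K, Matrix.mul_assoc Rᴴ]
  simp [Matrix.trace_mul_comm Rᴴ R]

section RealDetPencil

variable {τ : Type*} {m d : ℕ} {B : Fin m → Matrix (Fin d) (Fin d) ℂ}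

theorem pencil_sub_posSemidef (hB : ∀ i, (B i).PosSemidef)
    (hsum : ((1 : Matrix (Fin d) (Fin d) ℂ) - ∑ i, (B i).trace • B i).PosSemidef)
    (o : τ) (v : Fin m → τ) (y : τ → ℝ) (ho : 4 ≤ y o)
    (hv : ∀ i, -2 * (B i).trace.re ≤ y (v i)) :
    (pencil B o v (fun k => (y k : ℂ)) -
      (2 : ℂ) • (1 : Matrix (Fin d) (Fin d) ℂ)).PosSemidef := by
  have htr : ∀ i, (B i).trace = ((B i).trace.re : ℂ) := fun i =>
    Complex.ext rfl (Complex.le_def.mp (hB i).trace_nonneg).2.symm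
  have h1 : (((y o - 4 : ℝ) : ℂ) • (1 : Matrix (Fin d) (Fin d) ℂ)).PosSemidef :=
    Matrix.PosSemidef.one.smul (by exact_mod_cast sub_nonneg.mpr ho)
  have h2 : (∑ i, ((y (v i) + 2 * (B i).trace.re : ℝ) : ℂ) • B i).PosSemidef :=
    Matrix.posSemidef_sum _ fun i _ => (hB i).smul (by
      have := hv i
      exact_mod_cast (by linarith : 0 ≤ y (v i) + 2 * (B i).trace.re))
  have h3 := hsum.smul (show (0 : ℂ) ≤ 2 by norm_num)
  convert (h1.add h2).add h3 using 1
  simp only [pencil, Complex.ofReal_add, Complex.ofReal_mul, Complex.ofReal_sub,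
    Complex.ofReal_ofNat, ← htr, add_smul, Finset.sum_add_distrib, smul_sub, mul_smul,
    ← Finset.smul_sum, sub_smul]
  module

theorem aeval_detPencil_bounds [DecidableEq τ] (hB : ∀ i, (B i).PosSemidef)
    (hsum : ((1 : Matrix (Fin d) (Fin d) ℂ) - ∑ i, (B i).trace • B i).PosSemidef)
    {o : τ} {v : Fin m → τ} {R : MvPolynomial τ ℝ}
    (hR : MvPolynomial.map Complex.ofRealHom R = detPencil B o v)
    {y : τ → ℝ} (ho : 4 ≤ y o) (hv : ∀ i, -2 * (B i).trace.re ≤ y (v i)) :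
    0 < MvPolynomial.aeval y R ∧ ∀ j i, j ≠ o → (∀ k, v k = j ↔ k = i) →
      MvPolynomial.aeval y (MvPolynomial.pderiv j R) ≤
        (B i).trace.re / 2 * MvPolynomial.aeval y R := by
  have hM := pencil_sub_posSemidef hB hsum o v y ho hv
  have hcast : ∀ p : MvPolynomial τ ℝ, ((MvPolynomial.aeval y p : ℝ) : ℂ) =
      MvPolynomial.eval (fun k => (y k : ℂ)) (MvPolynomial.map Complex.ofRealHom p) := by
    intro p
    rw [MvPolynomial.eval_map]
    exact MvPolynomial.eval₂_comp_left Complex.ofRealHom (algebraMap ℝ ℝ) y p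
  have hdet : ((MvPolynomial.aeval y R : ℝ) : ℂ) = (pencil B o v fun k => (y k : ℂ)).det := by
    rw [hcast, hR, eval_detPencil]
  have hpos : 0 < MvPolynomial.aeval y R := by
    have := (trace_inv_mul_le hM Matrix.PosSemidef.one).1.det_pos
    rw [← hdet] at this
    exact_mod_cast this
  refine ⟨hpos, fun j i hj hvj => ?_⟩
  obtain ⟨hpd, htr⟩ := trace_inv_mul_le hM (hB i)
  have hd : ((MvPolynomial.aeval y (MvPolynomial.pderiv j R) : ℝ) : ℂ) =
      (MvPolynomial.aeval y R : ℝ) *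
        ((pencil B o v fun k => (y k : ℂ))⁻¹ * B i).trace := by
    rw [hcast, ← MvPolynomial.pderiv_map, hR,
      eval_pderiv_detPencil B o v j hj i hvj _ hpd.det_pos.ne', hdet]
  have hd' := congrArg Complex.re hd
  rw [Complex.ofReal_re, Complex.re_ofReal_mul] at hd'
  have htr' := (Complex.le_def.mp htr).1
  have hhalf : ((1 / 2 : ℂ) * (B i).trace).re = (B i).trace.re / 2 := by
    rw [show (1 / 2 : ℂ) = ((1 / 2 : ℝ) : ℂ) by norm_num, Complex.re_ofReal_mul]
    ring
  rw [Complex.zero_re, Complex.sub_re, hhalf] at htr'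
  rw [hd', mul_comm]
  exact mul_le_mul_of_nonneg_right (by linarith) hpos.le

theorem realStable_of_map_eq_detPencil (hB : ∀ i, (B i).PosSemidef) {o : τ} {v : Fin m → τ}
    {R : MvPolynomial τ ℝ} (hR : MvPolynomial.map Complex.ofRealHom R = detPencil B o v) :
    RealStable R := by
  intro z hz
  have : MvPolynomial.aeval z R = (pencil B o v z).det := by
    rw [← eval_detPencil, ← hR, MvPolynomial.eval_map]
    rfl
  rw [this]
  exact pencil_det_ne_zero B hB o v z hz

end RealDetPencil

theorem map_oneSubHalfPderiv {σ : Type*} (i : σ) (P : MvPolynomial σ ℝ) :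
    MvPolynomial.map Complex.ofRealHom (oneSubHalfPderiv ℝ i P) =
      oneSubHalfPderiv ℂ i (MvPolynomial.map Complex.ofRealHom P) := by
  simp [oneSubHalfPderiv_apply, MvPolynomial.pderiv_map, MvPolynomial.smul_eq_C_mul]

theorem map_prod_oneSubHalfPderiv {σ : Type*} (l : List σ) (P : MvPolynomial σ ℝ) :
    MvPolynomial.map Complex.ofRealHom ((l.map (oneSubHalfPderiv ℝ)).prod P) =
      (l.map (oneSubHalfPderiv ℂ)).prod (MvPolynomial.map Complex.ofRealHom P) := by
  induction l with
  | nil => simp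
  | cons a l ih => simp [map_oneSubHalfPderiv, ih]

theorem count_map_toList_of_injective {α β : Type*} [DecidableEq α] [DecidableEq β] {f : α → β}
    (hf : Function.Injective f) (S : Finset α) (a : α) :
    (S.toList.map f).count (f a) = if a ∈ S then 1 else 0 := by
  rw [List.count_map_of_injective _ _ hf, S.nodup_toList.count]
  simp

/-- `(4,0,…,0)` is above the roots of `∏_{i∈S} (1 − ½∂²_{z_i≡w_i}) Q`
(Lemma `qx`).  The diagonalization identifying `w_i` with `z_i` for `i ∈ S` is done
by `MvPolynomial.rename`, followed by the operators `1 − ½∂²_{z_i}`. -/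
theorem statement15 {m d : ℕ} (B : Fin m → Matrix (Fin d) (Fin d) ℂ)
    (hB : ∀ i, (B i).PosSemidef)
    (htr : ∀ i, ((B i).trace).re ≤ 1)
    (hsum : ((1 : Matrix (Fin d) (Fin d) ℂ) - ∑ i, (B i).trace • B i).PosSemidef)
    (S : Finset (Fin m)) :
    AboveRootsC
      ((S.toList.map fun i =>
          ((1 : Module.End ℂ (MvPolynomial (Option (Fin m ⊕ Fin m)) ℂ)) -
            (1 / 2 : ℂ) • ((MvPolynomial.pderiv (some (Sum.inl i))).toLinearMap ∘ₗ
              (MvPolynomial.pderiv (some (Sum.inl i))).toLinearMap) :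
            Module.End ℂ (MvPolynomial (Option (Fin m ⊕ Fin m)) ℂ))).prod
        (MvPolynomial.rename
          (fun v => match v with
            | none => none
            | some (Sum.inl i) => some (Sum.inl i)
            | some (Sum.inr i) => if i ∈ S then some (Sum.inl i) else some (Sum.inr i))
          (detProdPoly B)))
      (fun o => o.elim 4 fun _ => 0) := by
  set f : Option (Fin m ⊕ Fin m) → Option (Fin m ⊕ Fin m) := fun v => match v with
    | none => none
    | some (Sum.inl i) => some (Sum.inl i)
    | some (Sum.inr i) => if i ∈ S then some (Sum.inl i) else some (Sum.inr i) with hf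
  set v₁ : Fin m → Option (Fin m ⊕ Fin m) := fun i => some (Sum.inl i) with hv₁
  set v₂ : Fin m → Option (Fin m ⊕ Fin m) := fun i =>
    if i ∈ S then some (Sum.inl i) else some (Sum.inr i) with hv₂
  have hren : MvPolynomial.rename f (detProdPoly B) =
      detPencil B none v₁ * detPencil B none v₂ := by
    rw [show detProdPoly B = detPencil B none (fun i => some (Sum.inl i)) *
      detPencil B none (fun i => some (Sum.inr i)) from rfl, map_mul, rename_detPencil,
      rename_detPencil]
    rfl
  obtain ⟨R₁, hR₁⟩ := exists_real_detPencil B (fun i => (hB i).isHermitian) none v₁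
  obtain ⟨R₂, hR₂⟩ := exists_real_detPencil B (fun i => (hB i).isHermitian) none v₂
  have hstable : RealStable (R₁ * R₂) := fun z hz => by
    rw [map_mul]
    exact mul_ne_zero (realStable_of_map_eq_detPencil hB hR₁ z hz)
      (realStable_of_map_eq_detPencil hB hR₂ z hz)
  set r : Fin m → ℝ := fun i => (B i).trace.re with hr
  have hr0 : ∀ i, 0 ≤ r i := fun i => (Complex.le_def.mp (hB i).trace_nonneg).1
  set z₀ : Option (Fin m ⊕ Fin m) → ℝ := fun o => o.elim 4
    (Sum.elim (fun i => if i ∈ S then -2 * r i else 0) fun _ => 0) with hz₀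
  set φ : Option (Fin m ⊕ Fin m) → ℝ := fun o => o.elim 0 (Sum.elim r fun _ => 0) with hφ
  set δ : Option (Fin m ⊕ Fin m) → ℝ := fun o => o.elim 0 (Sum.elim (fun i => 2 * r i) fun _ => 0)
    with hδ
  set J : Set (Option (Fin m ⊕ Fin m)) := v₁ '' S with hJ
  have hbarrier : BarrierBound (R₁ * R₂) J φ z₀ := by
    intro y hy
    have ho : 4 ≤ y none := hy none
    have hy₁ : ∀ i, -2 * (B i).trace.re ≤ y (v₁ i) := fun i => by
      have h1 := hy (some (Sum.inl i))
      have h2 := hr0 i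
      simp only [hz₀, hr, Option.elim_some, Sum.elim_inl] at h1 h2
      split_ifs at h1 <;> linarith
    have hy₂ : ∀ i, -2 * (B i).trace.re ≤ y (v₂ i) := fun i => by
      by_cases hi : i ∈ S
      · simpa [hv₂, hi] using hy₁ i
      · have h1 : 0 ≤ y (some (Sum.inr i)) := hy (some (Sum.inr i))
        have h2 := hr0 i
        simp only [hv₂, hi, if_false]
        linarith
    obtain ⟨hp₁, hd₁⟩ := aeval_detPencil_bounds hB hsum hR₁ ho hy₁
    obtain ⟨hp₂, hd₂⟩ := aeval_detPencil_bounds hB hsum hR₂ ho hy₂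
    rw [map_mul]
    refine ⟨mul_pos hp₁ hp₂, ?_⟩
    rintro _ ⟨i, hi, rfl⟩
    have hi' : i ∈ S := hi
    have e₁ := hd₁ (v₁ i) i (by simp [hv₁]) fun k => by simp [hv₁]
    have e₂ := hd₂ (v₁ i) i (by simp [hv₁]) fun k => by
      by_cases hk : k ∈ S
      · simp [hv₁, hv₂, hk]
      · simp only [hv₁, hv₂, hk, if_false, Option.some.injEq, reduceCtorEq, false_iff]
        rintro rfl
        exact hk hi'
    rw [Derivation.leibniz, map_add, smul_eq_mul, smul_eq_mul, map_mul, map_mul]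
    have hφi : φ (v₁ i) = (B i).trace.re := rfl
    rw [hφi]
    nlinarith [mul_le_mul_of_nonneg_left e₂ hp₁.le, mul_le_mul_of_nonneg_left e₁ hp₂.le]
  have hmem : ∀ i ∈ S.toList.map v₁, i ∈ J := by
    intro i hi
    obtain ⟨k, hk, rfl⟩ := List.mem_map.mp hi
    exact ⟨k, Finset.mem_toList.mp hk, rfl⟩
  have hδ0 : ∀ i ∈ J, 0 ≤ δ i := by
    rintro _ ⟨i, -, rfl⟩
    exact mul_nonneg zero_le_two (hr0 i)
  have hφδ : ∀ i ∈ J, φ i + δ i * φ i ^ 2 / 2 ≤ δ i := by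
    rintro _ ⟨i, -, rfl⟩
    have h0 := hr0 i
    have h1 : r i ≤ 1 := htr i
    change r i + 2 * r i * r i ^ 2 / 2 ≤ 2 * r i
    nlinarith [mul_nonneg h0 (by nlinarith : 0 ≤ 1 - r i ^ 2)]
  have hφ2 : ∀ i ∈ J, φ i ^ 2 < 2 := by
    rintro _ ⟨i, -, rfl⟩
    have h0 := hr0 i
    have h1 : r i ≤ 1 := htr i
    change r i ^ 2 < 2
    nlinarith
  obtain ⟨-, hfinal⟩ := hbarrier.prod_oneSubHalfPderiv hstable hδ0 hφδ hφ2 _ hmem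
  intro t ht
  have hval := (hfinal (fun k => k.elim 4 (fun _ => 0) + t k) (by
      intro k
      have htk := ht k
      rcases k with _ | i | i
      · simpa [hz₀, hδ] using htk
      · simp only [hz₀, hδ, Option.elim_some, Sum.elim_inl]
        rw [show (some (Sum.inl i) : Option (Fin m ⊕ Fin m)) = v₁ i from rfl] at htk ⊢
        rw [count_map_toList_of_injective (fun a b h => by simpa [hv₁] using h)]
        split_ifs <;> simp <;> linarith
      · simpa [hz₀, hδ] using htk)).1
  have hpoly : (S.toList.map fun i => oneSubHalfPderiv ℂ (v₁ i)).prod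
      (MvPolynomial.rename f (detProdPoly B)) = MvPolynomial.map Complex.ofRealHom
        (((S.toList.map v₁).map (oneSubHalfPderiv ℝ)).prod (R₁ * R₂)) := by
    rw [map_prod_oneSubHalfPderiv, map_mul, hR₁, hR₂, hren, List.map_map]
    rfl
  have heval : MvPolynomial.eval (fun i => ((Option.elim i 4 (fun _ => 0) + t i : ℝ) : ℂ))
      ((S.toList.map fun i => oneSubHalfPderiv ℂ (v₁ i)).prod
        (MvPolynomial.rename f (detProdPoly B))) =
      ((MvPolynomial.aeval (fun k => Option.elim k 4 (fun _ => 0) + t k)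
        (((S.toList.map v₁).map (oneSubHalfPderiv ℝ)).prod (R₁ * R₂)) : ℝ) : ℂ) := by
    rw [hpoly, MvPolynomial.eval_map]
    exact (MvPolynomial.eval₂_comp_left Complex.ofRealHom (algebraMap ℝ ℝ) _ _).symm
  refine ⟨(congrArg Complex.im heval).trans (Complex.ofReal_im _), ?_⟩
  exact hval.trans_eq (congrArg Complex.re heval).symm
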